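/- Let ν > 0 and ε ∈ ℝ with 0 < |ε| < 1, set α = |ε|/ν and ⟨t⟩ = (1+t²)^{1/2}. Let u : ℝ → ℂ be twice continuously differentiable and suppose there is δ > |ε|/(2ν) with ∫_ℝ e^{2δ⟨t⟩}(|u(t)|² + |u′(t)|² + |u″(t)|²) dt < ∞. Set f(t) = u″(t) + (ν² − iε)u(t). Then the following integral identity holds: −2 Re ∫_ℝ f(t) · t · e^{α|t|} · conj(u′(t)) dt = ∫_ℝ e^{α|t|} |u′(t)|² dt + ∫_ℝ (α/|t|) e^{α|t|} | t u′(t) + i(ε/α)|t| u(t) |² dt + ν² ∫_ℝ e^{α|t|} |u(t)|² dt. -/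

import Mathlib

open MeasureTheory Real

/-- The weight `t e^{a|t|}` is differentiable everywhere, including at the origin. -/
lemma hasDerivAt_mul_exp_mul_abs (a t : ℝ) :
    HasDerivAt (fun s : ℝ => s * Real.exp (a * |s|)) ((1 + a * |t|) * Real.exp (a * |t|)) t := by
  rcases lt_trichotomy t 0 with h | rfl | h
  · have := (hasDerivAt_id t).mul ((((hasDerivAt_abs_neg h).const_mul a)).exp)
    refine this.congr_deriv ?_
    simp only [id, abs_of_neg h]
    ring
  · rw [hasDerivAt_iff_tendsto_slope]
    have hc : Continuous fun s : ℝ => Real.exp (a * |s|) := by fun_prop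
    have h0 := (hc.tendsto 0).mono_left (nhdsWithin_le_nhds (s := {0}ᶜ))
    have hv : (1 + a * |(0 : ℝ)|) * Real.exp (a * |(0 : ℝ)|) = Real.exp (a * |(0 : ℝ)|) := by simp
    rw [hv]
    refine h0.congr' ?_
    filter_upwards [self_mem_nhdsWithin] with s hs
    have hs' : s ≠ 0 := hs
    simp [slope_def_field, hs']
  · have := (hasDerivAt_id t).mul ((((hasDerivAt_abs_pos h).const_mul a)).exp)
    refine this.congr_deriv ?_
    simp only [id, abs_of_pos h]
    ring

/-- A polynomial loss is absorbed by an exponential gain in the rate. -/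
lemma one_add_abs_mul_exp_le {a b : ℝ} (hab : a < b) (hb : 0 ≤ b) (t : ℝ) :
    (1 + |t|) * Real.exp (a * |t|) ≤
      (1 + 1 / (b - a)) * Real.exp (b * Real.sqrt (1 + t ^ 2)) := by
  have hc : 0 < b - a := sub_pos.2 hab
  have h1 : (b - a) * |t| + 1 ≤ Real.exp ((b - a) * |t|) := Real.add_one_le_exp _
  have h2 : |t| ≤ 1 / (b - a) * Real.exp ((b - a) * |t|) := by
    rw [div_mul_eq_mul_div, one_mul, le_div_iff₀ hc]
    linarith
  have h3 : 1 + |t| ≤ (1 + 1 / (b - a)) * Real.exp ((b - a) * |t|) := by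
    have : 0 ≤ (b - a) * |t| := by positivity
    linarith
  calc (1 + |t|) * Real.exp (a * |t|)
      ≤ (1 + 1 / (b - a)) * Real.exp ((b - a) * |t|) * Real.exp (a * |t|) := by gcongr
    _ = (1 + 1 / (b - a)) * Real.exp (b * |t|) := by
        rw [mul_assoc, ← Real.exp_add]
        ring_nf
    _ ≤ (1 + 1 / (b - a)) * Real.exp (b * Real.sqrt (1 + t ^ 2)) := by
        gcongr
        exact Real.abs_le_sqrt (by linarith)

/-- Continuous functions of size at most `(1 + |t|) e^{a|t|} p(t)` are integrable when
`e^{b⟨t⟩} p(t)` is, for some `b > a`. -/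
lemma integrable_of_norm_le_one_add_abs_mul_exp {E : Type*} [NormedAddCommGroup E] {a b : ℝ}
    (hab : a < b) (hb : 0 ≤ b)
    {p : ℝ → ℝ} (hp0 : ∀ t, 0 ≤ p t)
    (hp : Integrable fun t : ℝ => Real.exp (b * Real.sqrt (1 + t ^ 2)) * p t)
    {h : ℝ → E} (hc : Continuous h) (K : ℝ) (hK : 0 ≤ K)
    (hle : ∀ t, ‖h t‖ ≤ K * ((1 + |t|) * Real.exp (a * |t|) * p t)) : Integrable h := by
  refine (hp.const_mul (K * (1 + 1 / (b - a)))).mono' hc.aestronglyMeasurable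
    (Filter.Eventually.of_forall fun t => (hle t).trans ?_)
  have := mul_le_mul_of_nonneg_right (one_add_abs_mul_exp_le hab hb t) (hp0 t)
  calc _ ≤ K * ((1 + 1 / (b - a)) * Real.exp (b * Real.sqrt (1 + t ^ 2)) * p t) := by gcongr
    _ = _ := by ring

/-- Integral identity for the 1-D Schrödinger equation `u″ + (ν² − iε)u = f` with
absorption `0 < |ε| < 1`, obtained by multiplying by `t e^{α|t|} conj(u′)` with
`α = |ε|/ν` and integrating by parts:
`−2 Re ∫ f t e^{α|t|} conj(u′) = ∫ e^{α|t|}|u′|² + ∫ (α/|t|)e^{α|t|}|tu′ + i(ε/α)|t|u|²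
  + ν² ∫ e^{α|t|}|u|²`. -/
theorem schrodinger_multiplier_identity (ν ε : ℝ) (hν : 0 < ν) (hε0 : 0 < |ε|)
    (hε : |ε| < 1) (u : ℝ → ℂ) (hu : ContDiff ℝ 2 u)
    (hdecay : ∃ δ : ℝ, |ε| / (2 * ν) < δ ∧
      Integrable (fun t : ℝ => Real.exp (2 * δ * Real.sqrt (1 + t ^ 2)) *
        (‖u t‖ ^ 2 + ‖deriv u t‖ ^ 2 + ‖deriv (deriv u) t‖ ^ 2))) :
    -2 * (∫ t : ℝ, (deriv (deriv u) t + ((ν : ℂ) ^ 2 - Complex.I * ε) * u t) * (t : ℂ) *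
        (Real.exp (|ε| / ν * |t|) : ℂ) * (starRingEnd ℂ) (deriv u t)).re =
      (∫ t : ℝ, Real.exp (|ε| / ν * |t|) * ‖deriv u t‖ ^ 2)
      + (∫ t : ℝ, (|ε| / ν) / |t| * Real.exp (|ε| / ν * |t|) *
          ‖(t : ℂ) * deriv u t + Complex.I * ((ε / (|ε| / ν) : ℝ) : ℂ) * (|t| : ℝ) * u t‖ ^ 2)
      + ν ^ 2 * ∫ t : ℝ, Real.exp (|ε| / ν * |t|) * ‖u t‖ ^ 2 := by
  obtain ⟨δ, hδ, hint⟩ := hdecay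
  set a := |ε| / ν with ha
  have ha0 : 0 < a := div_pos hε0 hν
  have hab : a < 2 * δ := by
    have : a = 2 * (|ε| / (2 * ν)) := by rw [ha]; field_simp
    linarith
  have hb : 0 ≤ 2 * δ := (ha0.trans hab).le
  set s := ε / a with hs
  have hsa : ε = s * a := by rw [hs]; field_simp
  have hs2 : s ^ 2 = ν ^ 2 := by
    have : ε ≠ 0 := abs_pos.1 hε0
    rw [hs, ha, div_pow, div_pow, sq_abs]
    field_simp
  obtain ⟨hdu, -, hu1⟩ := (contDiff_succ_iff_deriv (n := 1)).1 hu
  obtain ⟨hdv, -, hw⟩ := (contDiff_succ_iff_deriv (n := 0)).1 hu1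
  have hud : ∀ t, HasDerivAt u (deriv u t) t := fun t => (hdu t).hasDerivAt
  have hvd : ∀ t, HasDerivAt (deriv u) (deriv (deriv u) t) t := fun t => (hdv t).hasDerivAt
  have huc : Continuous u := hu.continuous
  have hvc : Continuous (deriv u) := hu1.continuous
  have hwc : Continuous (deriv (deriv u)) := hw.continuous
  generalize deriv (deriv u) = w at *
  generalize deriv u = v at *
  have hp0 : ∀ t, 0 ≤ ‖u t‖ ^ 2 + ‖v t‖ ^ 2 + ‖w t‖ ^ 2 := fun t => by positivity
  have key := fun {h : ℝ → ℝ} => integrable_of_norm_le_one_add_abs_mul_exp (h := h) hab hb hp0 hint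
  have keyC := fun {h : ℝ → ℂ} => integrable_of_norm_le_one_add_abs_mul_exp (h := h) hab hb hp0 hint
  have hweight : ∀ (t : ℝ) {x y : ℝ}, |x| ≤ 1 + |t| → |y| ≤ ‖u t‖ ^ 2 + ‖v t‖ ^ 2 + ‖w t‖ ^ 2 →
      ‖x * Real.exp (a * |t|) * y‖ ≤ 1 * ((1 + |t|) * Real.exp (a * |t|) *
        (‖u t‖ ^ 2 + ‖v t‖ ^ 2 + ‖w t‖ ^ 2)) := by
    intro t x y hx hy
    rw [Real.norm_eq_abs, abs_mul, abs_mul, Real.abs_exp, one_mul]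
    gcongr
  have hbil : ∀ z₁ z₂ : ℂ, |inner ℝ z₁ z₂| ≤ ‖z₁‖ ^ 2 + ‖z₂‖ ^ 2 := fun z₁ z₂ => by
    have := abs_real_inner_le_norm z₁ z₂
    nlinarith [sq_nonneg (‖z₁‖ - ‖z₂‖), sq_nonneg (‖z₁‖), sq_nonneg ‖z₂‖]
  have hsum : ∀ {x : ℝ → ℝ} {z₁ z₂ : ℝ → ℂ}, Continuous x → Continuous z₁ → Continuous z₂ →
      (∀ t, |x t| ≤ 1 + |t|) →
      (∀ t, ‖z₁ t‖ ^ 2 + ‖z₂ t‖ ^ 2 ≤ ‖u t‖ ^ 2 + ‖v t‖ ^ 2 + ‖w t‖ ^ 2) →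
      Integrable fun t => x t * Real.exp (a * |t|) * inner ℝ (z₁ t) (z₂ t) :=
    fun hx h₁ h₂ hxt hz => key (by fun_prop) 1 zero_le_one fun t =>
      hweight t (hxt t) ((hbil _ _).trans (hz t))
  have hsq : ∀ {x : ℝ → ℝ} {z : ℝ → ℂ}, Continuous x → Continuous z → (∀ t, |x t| ≤ 1 + |t|) →
      (∀ t, ‖z t‖ ^ 2 ≤ ‖u t‖ ^ 2 + ‖v t‖ ^ 2 + ‖w t‖ ^ 2) →
      Integrable fun t => x t * Real.exp (a * |t|) * ‖z t‖ ^ 2 :=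
    fun hx h₁ hxt hz => key (by fun_prop) 1 zero_le_one fun t =>
      hweight t (hxt t) (by rw [abs_of_nonneg (by positivity)]; exact hz t)
  have hx1 : ∀ t : ℝ, |(1 : ℝ)| ≤ 1 + |t| := fun t => by simp
  have hxt : ∀ t : ℝ, |t| ≤ 1 + |t| := fun t => by simp
  have hxa : ∀ t : ℝ, |(|t|)| ≤ 1 + |t| := fun t => by simp
  have hule : ∀ t, ‖u t‖ ^ 2 ≤ ‖u t‖ ^ 2 + ‖v t‖ ^ 2 + ‖w t‖ ^ 2 := fun t => by
    nlinarith [sq_nonneg ‖v t‖, sq_nonneg ‖w t‖]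
  have hvle : ∀ t, ‖v t‖ ^ 2 ≤ ‖u t‖ ^ 2 + ‖v t‖ ^ 2 + ‖w t‖ ^ 2 := fun t => by
    nlinarith [sq_nonneg ‖u t‖, sq_nonneg ‖w t‖]
  have hE_v : Integrable fun t : ℝ => Real.exp (a * |t|) * ‖v t‖ ^ 2 := by
    simpa using hsq continuous_const hvc hx1 hvle
  have hE_u : Integrable fun t : ℝ => Real.exp (a * |t|) * ‖u t‖ ^ 2 := by
    simpa using hsq continuous_const huc hx1 hule
  have habs_v := hsq continuous_abs hvc hxa hvle
  have habs_u := hsq continuous_abs huc hxa hule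
  have ht_v := hsq continuous_id hvc hxt hvle
  have ht_u := hsq continuous_id huc hxt hule
  have ht_vw := hsum continuous_id hvc hwc hxt fun t => by nlinarith [sq_nonneg ‖u t‖]
  have ht_uv := hsum continuous_id huc hvc hxt fun t => by nlinarith [sq_nonneg ‖w t‖]
  have ht_iuv := hsum (z₁ := fun t => Complex.I * u t) continuous_id (by fun_prop) hvc hxt
    fun t => by simp
  simp only [id] at ht_v ht_u ht_vw ht_uv ht_iuv
  have hderiv : ∀ t, HasDerivAt
      (fun t : ℝ => t * Real.exp (a * |t|) * ‖v t‖ ^ 2 + ν ^ 2 * (t * Real.exp (a * |t|) * ‖u t‖ ^ 2))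
      ((Real.exp (a * |t|) * ‖v t‖ ^ 2 + a * (|t| * Real.exp (a * |t|) * ‖v t‖ ^ 2)
          + 2 * (t * Real.exp (a * |t|) * inner ℝ (v t) (w t)))
        + ν ^ 2 * (Real.exp (a * |t|) * ‖u t‖ ^ 2 + a * (|t| * Real.exp (a * |t|) * ‖u t‖ ^ 2)
          + 2 * (t * Real.exp (a * |t|) * inner ℝ (u t) (v t)))) t := fun t => by
    have h := hasDerivAt_mul_exp_mul_abs a t
    refine ((h.mul (hvd t).norm_sq).add ((h.mul (hud t).norm_sq).const_mul (ν ^ 2))).congr_deriv ?_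
    ring
  have hI1 := (hE_v.fun_add (habs_v.const_mul a)).fun_add (ht_vw.const_mul 2)
  have hI2 := (hE_u.fun_add (habs_u.const_mul a)).fun_add (ht_uv.const_mul 2)
  have hzero := integral_eq_zero_of_hasDerivAt_of_integrable hderiv
    (hI1.fun_add (hI2.const_mul (ν ^ 2))) (ht_v.fun_add (ht_u.const_mul (ν ^ 2)))
  have hcross : ∀ t : ℝ, a / |t| * Real.exp (a * |t|) *
      ‖(t : ℂ) * v t + Complex.I * (s : ℂ) * (|t| : ℝ) * u t‖ ^ 2 =
      a * (|t| * Real.exp (a * |t|) * ‖v t‖ ^ 2) + ν ^ 2 * a * (|t| * Real.exp (a * |t|) * ‖u t‖ ^ 2)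
        + 2 * ε * (t * Real.exp (a * |t|) * inner ℝ (Complex.I * u t) (v t)) := fun t => by
    have hn : ‖(t : ℂ) * v t + Complex.I * (s : ℂ) * (|t| : ℝ) * u t‖ ^ 2 =
        |t| * (|t| * ‖v t‖ ^ 2 + ν ^ 2 * |t| * ‖u t‖ ^ 2
          + 2 * s * t * inner ℝ (Complex.I * u t) (v t)) := by
      rw [← hs2]
      simp only [Complex.inner, Complex.sq_norm, Complex.normSq_apply, Complex.add_re,
        Complex.add_im, Complex.mul_re, Complex.mul_im, Complex.ofReal_re, Complex.ofReal_im,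
        Complex.I_re, Complex.I_im, map_mul, Complex.conj_re, Complex.conj_im]
      linear_combination (-(v t).re ^ 2 - (v t).im ^ 2) * abs_mul_abs_self t
    rw [hn, hsa]
    rcases eq_or_ne t 0 with rfl | ht
    · simp
    · have : |t| ≠ 0 := abs_ne_zero.2 ht
      field_simp
  have hlhs : ∀ t : ℝ, ((w t + ((ν : ℂ) ^ 2 - Complex.I * ε) * u t) * (t : ℂ) *
      (Real.exp (a * |t|) : ℂ) * (starRingEnd ℂ) (v t)).re =
      t * Real.exp (a * |t|) * inner ℝ (v t) (w t)
        + ν ^ 2 * (t * Real.exp (a * |t|) * inner ℝ (u t) (v t))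
        - ε * (t * Real.exp (a * |t|) * inner ℝ (Complex.I * u t) (v t)) := fun t => by
    rw [← Complex.ofReal_pow]
    simp only [Complex.inner, Complex.add_re, Complex.sub_re, Complex.sub_im,
        Complex.add_im, Complex.mul_re, Complex.mul_im, Complex.ofReal_re, Complex.ofReal_im,
        Complex.I_re, Complex.I_im, map_mul, Complex.conj_re, Complex.conj_im]
    ring
  have hF : Integrable fun t : ℝ => (w t + ((ν : ℂ) ^ 2 - Complex.I * ε) * u t) * (t : ℂ) *
      (Real.exp (a * |t|) : ℂ) * (starRingEnd ℂ) (v t) := by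
    refine keyC (by fun_prop) (1 + ‖(ν : ℂ) ^ 2 - Complex.I * ε‖) (by positivity) fun t => ?_
    set c := ‖(ν : ℂ) ^ 2 - Complex.I * ε‖
    have hc : 0 ≤ c := norm_nonneg _
    have h1 : ‖w t + ((ν : ℂ) ^ 2 - Complex.I * ε) * u t‖ ≤ ‖w t‖ + c * ‖u t‖ :=
      (norm_add_le _ _).trans (by rw [norm_mul])
    have h2 : (‖w t‖ + c * ‖u t‖) * ‖v t‖ ≤
        (1 + c) * (‖u t‖ ^ 2 + ‖v t‖ ^ 2 + ‖w t‖ ^ 2) := by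
      have hwv : ‖w t‖ * ‖v t‖ ≤ ‖u t‖ ^ 2 + ‖v t‖ ^ 2 + ‖w t‖ ^ 2 := by
        nlinarith [sq_nonneg (‖w t‖ - ‖v t‖), sq_nonneg ‖u t‖, sq_nonneg ‖v t‖, sq_nonneg ‖w t‖]
      have huv : ‖u t‖ * ‖v t‖ ≤ ‖u t‖ ^ 2 + ‖v t‖ ^ 2 + ‖w t‖ ^ 2 := by
        nlinarith [sq_nonneg (‖u t‖ - ‖v t‖), sq_nonneg ‖u t‖, sq_nonneg ‖v t‖, sq_nonneg ‖w t‖]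
      linarith [mul_le_mul_of_nonneg_left huv hc]
    rw [norm_mul, norm_mul, norm_mul, RCLike.norm_conj, Complex.norm_real, Complex.norm_real,
      Real.norm_eq_abs, Real.norm_eq_abs, Real.abs_exp]
    calc _ ≤ (‖w t‖ + c * ‖u t‖) * |t| * Real.exp (a * |t|) * ‖v t‖ := by gcongr
      _ = |t| * Real.exp (a * |t|) * ((‖w t‖ + c * ‖u t‖) * ‖v t‖) := by ring
      _ ≤ (1 + |t|) * Real.exp (a * |t|) *
          ((1 + c) * (‖u t‖ ^ 2 + ‖v t‖ ^ 2 + ‖w t‖ ^ 2)) := by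
        gcongr
        exact hxt t
      _ = _ := by ring
  have hre := Complex.reCLM.integral_comp_comm hF
  simp only [Complex.reCLM_apply] at hre
  rw [← hre]
  simp only [hlhs, hcross]
  rw [integral_sub (ht_vw.fun_add (ht_uv.const_mul _)) (ht_iuv.const_mul _),
    integral_add ht_vw (ht_uv.const_mul _),
    integral_add ((habs_v.const_mul _).fun_add (habs_u.const_mul _)) (ht_iuv.const_mul _),
    integral_add (habs_v.const_mul _) (habs_u.const_mul _)]
  rw [integral_add hI1 (hI2.const_mul _), integral_const_mul,
    integral_add (hE_v.fun_add (habs_v.const_mul a)) (ht_vw.const_mul 2),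
    integral_add hE_v (habs_v.const_mul a),
    integral_add (hE_u.fun_add (habs_u.const_mul a)) (ht_uv.const_mul 2),
    integral_add hE_u (habs_u.const_mul a)] at hzero
  simp only [integral_const_mul] at hzero ⊢
  linarith
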